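/- arXiv:2504.03039 — 12 statements merged into one kernel-verified Lean document; each statement's English description precedes it below -/
import Mathlib

section
/- Let a and b be positive integers such that a+b is odd. Then the pair (a,b) is not pourable, i.e., there is no positive integer p with f^p(a,b) = (a+b, 0). -/
/-- The two-dimensional pouring function. -/
def pourFun : ℕ × ℕ → ℕ × ℕ :=
  fun p => if p.1 ≤ p.2 then (2 * p.1, p.2 - p.1) else (p.1 - p.2, 2 * p.2)

/-- A pair `(a,b)` is pourable if some positive number of iterations of the
pouring function sends it to `(a+b, 0)`. -/
def Pourable2 (a b : ℕ) : Prop :=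
  ∃ p : ℕ, 0 < p ∧ pourFun^[p] (a, b) = (a + b, 0)

/-- Pouring preserves the total, and when the total is odd it keeps both entries positive. -/
theorem pourFun_iterate_pos {a b : ℕ} (ha : 0 < a) (hb : 0 < b) (hodd : Odd (a + b)) (p : ℕ) :
    0 < (pourFun^[p] (a, b)).1 ∧ 0 < (pourFun^[p] (a, b)).2 ∧
      (pourFun^[p] (a, b)).1 + (pourFun^[p] (a, b)).2 = a + b := by
  obtain ⟨k, hk⟩ := hodd
  induction p with
  | zero => exact ⟨ha, hb, rfl⟩
  | succ p ih =>
    rw [Function.iterate_succ_apply']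
    obtain ⟨h₁, h₂, hsum⟩ := ih
    unfold pourFun at *
    split_ifs <;> dsimp only <;> omega

theorem stmt0 (a b : ℕ) (ha : 0 < a) (hb : 0 < b) (hodd : Odd (a + b)) :
    ¬ Pourable2 a b := by
  rintro ⟨p, -, hp⟩
  have hpos := (pourFun_iterate_pos ha hb hodd p).2.1
  simp [hp] at hpos
end

section
/- Let a and b be positive integers. The pair (a,b) is pourable if and only if the pair (a/gcd(a,b), b/gcd(a,b)) is pourable. -/
theorem semiconj_smul_pourFun (d : ℕ) : Function.Semiconj (d • ·) pourFun pourFun := by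
  intro p
  symm
  obtain rfl | hd := Nat.eq_zero_or_pos d
  · simp [pourFun]
  · simp only [pourFun, Prod.smul_fst, Prod.smul_snd, smul_eq_mul, Nat.mul_le_mul_left_iff hd]
    split_ifs <;> simp [Nat.mul_sub, Nat.mul_left_comm]

theorem pourable2_mul_iff {d : ℕ} (hd : 0 < d) (a b : ℕ) :
    Pourable2 (d * a) (d * b) ↔ Pourable2 a b := by
  have iterate_smul (n : ℕ) : pourFun^[n] (d * a, d * b) = d • pourFun^[n] (a, b) :=
    ((semiconj_smul_pourFun d).iterate_right n (a, b)).symm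
  simp [Pourable2, iterate_smul, Prod.ext_iff, ← Nat.mul_add, hd.ne']

theorem stmt1 (a b : ℕ) (ha : 0 < a) (hb : 0 < b) :
    Pourable2 a b ↔ Pourable2 (a / Nat.gcd a b) (b / Nat.gcd a b) := by
  have hd : 0 < Nat.gcd a b := Nat.gcd_pos_of_pos_left b ha
  rw [← pourable2_mul_iff hd (a / Nat.gcd a b), Nat.mul_div_cancel' (Nat.gcd_dvd_left a b),
    Nat.mul_div_cancel' (Nat.gcd_dvd_right a b)]
end

section
/- Let a and b be positive integers. The pair (a,b) is pourable if and only if (a+b)/gcd(a,b) = 2^k for some positive integer k. -/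
theorem pourFun_sum (x : ℕ × ℕ) : (pourFun x).1 + (pourFun x).2 = x.1 + x.2 := by
  unfold pourFun
  split_ifs <;> simp only <;> omega

theorem pourFun_fst_pos {x : ℕ × ℕ} (hx : 0 < x.1) : 0 < (pourFun x).1 := by
  unfold pourFun
  split_ifs <;> simp only <;> omega

/-- Pouring doubles the first coordinate modulo the total. -/
theorem pourFun_fst_modEq (x : ℕ × ℕ) : (pourFun x).1 ≡ 2 * x.1 [MOD x.1 + x.2] := by
  unfold pourFun
  split_ifs with h
  · rfl
  · have h2 : 2 * x.1 = (x.1 - x.2) + (x.1 + x.2) := by omega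
    rw [h2]
    exact Nat.add_modEq_right.symm

theorem pourFun_iterate_sum (x : ℕ × ℕ) (p : ℕ) :
    (pourFun^[p] x).1 + (pourFun^[p] x).2 = x.1 + x.2 := by
  induction p with
  | zero => rfl
  | succ p ih => rw [Function.iterate_succ_apply', pourFun_sum, ih]

theorem pourFun_iterate_fst_pos {x : ℕ × ℕ} (hx : 0 < x.1) (p : ℕ) :
    0 < (pourFun^[p] x).1 := by
  induction p with
  | zero => exact hx
  | succ p ih =>
    rw [Function.iterate_succ_apply']
    exact pourFun_fst_pos ih

theorem pourFun_iterate_fst_modEq (x : ℕ × ℕ) (p : ℕ) :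
    (pourFun^[p] x).1 ≡ 2 ^ p * x.1 [MOD x.1 + x.2] := by
  induction p with
  | zero => simp [Nat.ModEq]
  | succ p ih =>
    have h := pourFun_fst_modEq (pourFun^[p] x)
    rw [pourFun_iterate_sum] at h
    rw [Function.iterate_succ_apply', pow_succ', mul_assoc]
    exact h.trans (ih.mul_left 2)

theorem pourFun_iterate_eq_iff {a b : ℕ} (ha : 0 < a) (p : ℕ) :
    pourFun^[p] (a, b) = (a + b, 0) ↔ a + b ∣ 2 ^ p * a := by
  have hsum := pourFun_iterate_sum (a, b) p
  have hpos := pourFun_iterate_fst_pos (x := (a, b)) ha p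
  rw [← (pourFun_iterate_fst_modEq (a, b) p).dvd_iff dvd_rfl]
  simp only at hsum ⊢
  constructor
  · intro h
    rw [h]
  · intro h
    have := Nat.le_of_dvd hpos h
    ext <;> simp only <;> omega

theorem dvd_mul_iff_div_gcd_dvd {n a : ℕ} (ha : 0 < a) (m : ℕ) :
    n ∣ m * a ↔ n / Nat.gcd n a ∣ m := by
  have hg : 0 < Nat.gcd n a := Nat.gcd_pos_of_pos_right n ha
  rw [← (Nat.coprime_div_gcd_div_gcd hg).dvd_mul_right,
    ← Nat.mul_dvd_mul_iff_right (b := m * (a / Nat.gcd n a)) hg, mul_assoc,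
    Nat.div_mul_cancel (Nat.gcd_dvd_left n a), Nat.div_mul_cancel (Nat.gcd_dvd_right n a)]

theorem stmt2 (a b : ℕ) (ha : 0 < a) (hb : 0 < b) :
    Pourable2 a b ↔ ∃ k : ℕ, 0 < k ∧ (a + b) / Nat.gcd a b = 2 ^ k := by
  simp only [Pourable2, pourFun_iterate_eq_iff ha, dvd_mul_iff_div_gcd_dvd ha,
    Nat.gcd_self_add_left, Nat.gcd_comm b a]
  constructor
  · rintro ⟨p, -, h⟩
    obtain ⟨k, -, hk⟩ := (Nat.dvd_prime_pow Nat.prime_two).1 h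
    refine ⟨k, Nat.pos_of_ne_zero ?_, hk⟩
    rintro rfl
    have hle : Nat.gcd a b ≤ a := Nat.gcd_le_left b ha
    have hmul := Nat.div_mul_cancel (Nat.dvd_add (Nat.gcd_dvd_left a b) (Nat.gcd_dvd_right a b))
    rw [hk] at hmul
    omega
  · rintro ⟨k, hk, h⟩
    exact ⟨k, hk, h.dvd⟩
end

section
/- Let a, b and k be positive integers with (a+b)/gcd(a,b) = 2^k. Then the pair (a,b) is pourable in exactly k steps: f^k(a,b) = (a+b, 0), and f^q(a,b) ≠ (a+b, 0) for every nonnegative integer q < k. -/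
theorem pourFun_of_le {g x z : ℕ} :
    pourFun (g * x, g * (x + 2 * z)) = (2 * g * x, 2 * g * z) := by
  have hle : g * x ≤ g * (x + 2 * z) := Nat.mul_le_mul_left g (Nat.le_add_right _ _)
  simp only [pourFun, if_pos hle, Prod.mk.injEq]
  refine ⟨by ring, ?_⟩
  rw [← Nat.mul_sub, Nat.add_sub_cancel_left]
  ring

theorem pourFun_of_lt {g y z : ℕ} (hg : 0 < g) (hz : 0 < z) :
    pourFun (g * (y + 2 * z), g * y) = (2 * g * z, 2 * g * y) := by
  have hlt : ¬ g * (y + 2 * z) ≤ g * y :=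
    not_le.2 (Nat.mul_lt_mul_of_pos_left (by omega) hg)
  simp only [pourFun, if_neg hlt, Prod.mk.injEq]
  refine ⟨?_, by ring⟩
  rw [← Nat.mul_sub, Nat.add_sub_cancel_left]
  ring

/-- Each pouring step halves the sum of an odd pair with sum `2 ^ (k + 1)`, after doubling
the common factor `g`. -/
theorem pourFun_iterate_of_odd (k : ℕ) : ∀ {g x y : ℕ}, 0 < g → Odd x →
    x + y = 2 ^ (k + 1) →
    pourFun^[k + 1] (g * x, g * y) = (g * 2 ^ (k + 1), 0) ∧
      ∀ q < k + 1, pourFun^[q] (g * x, g * y) ≠ (g * 2 ^ (k + 1), 0) := by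
  induction k with
  | zero =>
    rintro g x y hg ⟨m, rfl⟩ hs
    obtain rfl : m = 0 := by omega
    obtain rfl : y = 1 := by omega
    refine ⟨by simp [pourFun, mul_comm], fun q hq => ?_⟩
    obtain rfl : q = 0 := by omega
    simp [hg.ne']
  | succ k ih =>
    intro g x y hg hx hs
    have hpow : 2 ^ (k + 1 + 1) = 2 * 2 ^ (k + 1) := by ring
    have heven : 2 ^ (k + 1) = 2 * 2 ^ k := by ring
    obtain ⟨m, hm⟩ := hx
    obtain ⟨x', y', hx', hs', hstep⟩ : ∃ x' y', Odd x' ∧ x' + y' = 2 ^ (k + 1) ∧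
        pourFun (g * x, g * y) = (2 * g * x', 2 * g * y') := by
      rcases le_or_gt x y with hxy | hxy
      · obtain ⟨z, rfl⟩ : ∃ z, y = x + 2 * z := ⟨(y - x) / 2, by omega⟩
        exact ⟨x, z, ⟨m, hm⟩, by omega, pourFun_of_le⟩
      · obtain ⟨z, rfl⟩ : ∃ z, x = y + 2 * z := ⟨(x - y) / 2, by omega⟩
        exact ⟨z, y, Nat.odd_iff.2 (by omega), by omega, pourFun_of_lt hg (by omega)⟩
    obtain ⟨hend, hne⟩ := ih (Nat.mul_pos two_pos hg) hx' hs'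
    have hsum : 2 * g * 2 ^ (k + 1) = g * 2 ^ (k + 1 + 1) := by ring
    rw [hsum] at hend hne
    refine ⟨by rw [Function.iterate_succ_apply, hstep, hend], fun q hq => ?_⟩
    cases q with
    | zero =>
      have hy : y ≠ 0 := by omega
      simp [hg.ne', hy]
    | succ q =>
      rw [Function.iterate_succ_apply, hstep]
      exact hne q (by omega)

theorem stmt3 (a b k : ℕ) (ha : 0 < a) (hb : 0 < b) (hk : 0 < k)
    (h : (a + b) / Nat.gcd a b = 2 ^ k) :
    pourFun^[k] (a, b) = (a + b, 0) ∧
      ∀ q : ℕ, q < k → pourFun^[q] (a, b) ≠ (a + b, 0) := by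
  obtain ⟨k, rfl⟩ := Nat.exists_eq_succ_of_ne_zero hk.ne'
  have hg : 0 < Nat.gcd a b := Nat.gcd_pos_of_pos_left b ha
  obtain ⟨x, y, hxy, hx, hy⟩ := Nat.exists_coprime a b
  generalize Nat.gcd a b = g at *
  subst hx hy
  rw [← add_mul, Nat.mul_div_cancel _ hg] at h
  have hodd : Odd x := by
    rw [← Nat.not_even_iff_odd]
    intro hev
    have hpow : 2 ^ (k + 1) = 2 * 2 ^ k := by ring
    have hdvd : 2 ∣ y := by
      have := hev.two_dvd
      omega
    exact absurd (Nat.dvd_gcd hev.two_dvd hdvd) (by rw [hxy.gcd_eq_one]; norm_num)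
  rw [← add_mul, h, mul_comm x, mul_comm y, mul_comm _ g]
  exact pourFun_iterate_of_odd k hg hodd h
end

section
/- For every positive integer N, g(N,3) ≥ 2^{√N}; equivalently, every state (a,b,c) on 3 vessels with sum n = a+b+c that is not (N−1)-pourable satisfies n ≥ 2^{√N}. -/
/-- A single pouring step between two vessels of a state on `k` vessels:
choose `i ≠ j` with `A i ≤ A j`, replace `A i` by `2 * A i` and `A j` by
`A j - A i`. -/
def PourStep {k : ℕ} (A B : Fin k → ℕ) : Prop :=
  ∃ i j : Fin k, i ≠ j ∧ A i ≤ A j ∧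
    B = Function.update (Function.update A i (2 * A i)) j (A j - A i)

/-- `PourSteps m A B` : the state `B` is reachable from `A` in exactly `m`
pouring steps. -/
def PourSteps {k : ℕ} : ℕ → (Fin k → ℕ) → (Fin k → ℕ) → Prop
  | 0, A, B => B = A
  | m + 1, A, B => ∃ C, PourStep A C ∧ PourSteps m C B

/-- A state is `p`-pourable if at most `p` pouring steps lead to a state
with an empty vessel. -/
def Pourable {k : ℕ} (p : ℕ) (A : Fin k → ℕ) : Prop :=
  ∃ m ≤ p, ∃ B : Fin k → ℕ, PourSteps m A B ∧ ∃ i, B i = 0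

theorem PourSteps.trans {k p q : ℕ} {A B C : Fin k → ℕ} (hAB : PourSteps p A B)
    (hBC : PourSteps q B C) : PourSteps (p + q) A C := by
  induction p generalizing A with
  | zero =>
    obtain rfl : B = A := hAB
    simpa using hBC
  | succ p ih =>
    obtain ⟨D, hD, hDB⟩ := hAB
    rw [Nat.succ_add]
    exact ⟨D, hD, ih hDB⟩

theorem PourStep.pourSteps {k : ℕ} {A B : Fin k → ℕ} (h : PourStep A B) : PourSteps 1 A B :=
  ⟨B, h, rfl⟩

theorem PourSteps.pourable {k p q : ℕ} {A B : Fin k → ℕ} (h : PourSteps p A B)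
    (hB : Pourable q B) : Pourable (p + q) A := by
  obtain ⟨m, hm, C, hC, h0⟩ := hB
  exact ⟨p + m, by omega, C, h.trans hC, h0⟩

theorem Pourable.mono {k p q : ℕ} {A : Fin k → ℕ} (h : Pourable p A) (hpq : p ≤ q) :
    Pourable q A := by
  obtain ⟨m, hm, hA⟩ := h
  exact ⟨m, hm.trans hpq, hA⟩

theorem PourStep.sum_eq {A B : Fin 3 → ℕ} (h : PourStep A B) : ∑ i, B i = ∑ i, A i := by
  obtain ⟨i, j, hij, hle, rfl⟩ := h
  fin_cases i <;> fin_cases j <;> simp_all [Fin.sum_univ_three, Function.update_apply] <;> omega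

theorem PourSteps.sum_eq {p : ℕ} {A B : Fin 3 → ℕ} (h : PourSteps p A B) :
    ∑ i, B i = ∑ i, A i := by
  induction p generalizing A with
  | zero => rw [show B = A from h]
  | succ p ih =>
    obtain ⟨C, hC, hCB⟩ := h
    rw [ih hCB, hC.sum_eq]

/-- Following the binary digits of `m`, the content of `x` can be doubled `d` times while
exactly `m` times its original content is taken from `y` and the rest from `z`. -/
theorem exists_pourSteps_of_binary {k d m l : ℕ} {x y z : Fin k} (hxy : x ≠ y) (hxz : x ≠ z)
    (hyz : y ≠ z) {A : Fin k → ℕ} (hd : m + l + 1 = 2 ^ d) (hy : m * A x ≤ A y)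
    (hz : l * A x ≤ A z) :
    ∃ B, PourSteps d A B ∧ B x = 2 ^ d * A x ∧ B y + m * A x = A y := by
  induction d generalizing A m l with
  | zero =>
    obtain rfl : m = 0 := by simp at hd; omega
    exact ⟨A, rfl, by simp, by simp⟩
  | succ d ih =>
    rw [pow_succ] at hd
    obtain ⟨m', rfl | rfl⟩ := m.even_or_odd'
    · obtain ⟨l', rfl⟩ : ∃ l', l = 2 * l' + 1 := ⟨l / 2, by omega⟩
      have hle : A x ≤ A z := by nlinarith
      let C := Function.update (Function.update A x (2 * A x)) z (A z - A x)
      have hCx : C x = 2 * A x := by simp [C, hxz]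
      have hCy : C y = A y := by simp [C, hyz, hxy.symm]
      have hCz : C z = A z - A x := by simp [C]
      obtain ⟨B, hB, hBx, hBy⟩ := ih (A := C) (m := m') (l := l') (by omega)
        (by rw [hCx, hCy]; linarith)
        (by rw [hCx, hCz]; apply Nat.le_sub_of_add_le; linarith)
      refine ⟨B, ⟨C, ⟨x, z, hxz, hle, rfl⟩, hB⟩, ?_, ?_⟩
      · rw [hBx, hCx]; ring
      · rw [← hCy, ← hBy, hCx]; ring
    · obtain ⟨l', rfl⟩ : ∃ l', l = 2 * l' := ⟨l / 2, by omega⟩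
      have hle : A x ≤ A y := by nlinarith
      let C := Function.update (Function.update A x (2 * A x)) y (A y - A x)
      have hCx : C x = 2 * A x := by simp [C, hxy]
      have hCy : C y = A y - A x := by simp [C]
      have hCz : C z = A z := by simp [C, hyz.symm, hxz.symm]
      obtain ⟨B, hB, hBx, hBy⟩ := ih (A := C) (m := m') (l := l') (by omega)
        (by rw [hCx, hCy]; apply Nat.le_sub_of_add_le; linarith)
        (by rw [hCx, hCz]; linarith)
      refine ⟨B, ⟨C, ⟨x, y, hxy, hle, rfl⟩, hB⟩, ?_, ?_⟩
      · rw [hBx, hCx]; ring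
      · rw [hCx, hCy] at hBy
        have : A y = (A y - A x) + A x := by omega
        rw [this, ← hBy]; ring

/-- The smallest content can be halved in at most `log₂` of the total many steps, by replacing it
with the distance from `A y` to the nearest multiple of `A x`. -/
theorem exists_pourSteps_two_mul_le {k : ℕ} {x y z : Fin k} (hxy : x ≠ y) (hxz : x ≠ z)
    (hyz : y ≠ z) {A : Fin k → ℕ} (hx : 0 < A x) (hxy' : A x ≤ A y) (hyz' : A y ≤ A z) :
    ∃ p ≤ Nat.log 2 (A x + A y + A z), ∃ B, PourSteps p A B ∧ ∃ i, 2 * B i ≤ A x := by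
  have hqr := Nat.div_add_mod (A y) (A x)
  have hr := Nat.mod_lt (A y) hx
  have hq : 0 < A y / A x := Nat.div_pos hxy' hx
  generalize A y / A x = q at *
  generalize A y % A x = r at *
  have steps_le {d : ℕ} (h : 2 ^ d * (2 * A x) ≤ A x + A y + A z) :
      d + 1 ≤ Nat.log 2 (A x + A y + A z) := by
    apply Nat.le_log_of_pow_le one_lt_two
    rw [pow_succ]
    nlinarith [Nat.two_pow_pos d]
  rcases le_or_gt (2 * r) (A x) with hcase | hcase
  · have hdq : 2 ^ Nat.log 2 q ≤ q := Nat.pow_log_le_self 2 hq.ne'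
    have hqd : q < 2 ^ (Nat.log 2 q + 1) := Nat.lt_pow_succ_log_self one_lt_two q
    generalize Nat.log 2 q = d at *
    rw [pow_succ] at hqd
    obtain ⟨m, rfl⟩ := Nat.exists_eq_add_of_le hdq
    obtain ⟨l, hl⟩ : ∃ l, m + l + 1 = 2 ^ d := ⟨2 ^ d - 1 - m, by omega⟩
    obtain ⟨B, hB, hBx, hBy⟩ := exists_pourSteps_of_binary hxy hxz hyz (A := A) hl
      (by nlinarith) (by nlinarith)
    have hBr : B y = B x + r := by nlinarith
    refine ⟨d + 1, steps_le (by nlinarith), _,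
      hB.trans (PourStep.pourSteps ⟨x, y, hxy, by omega, rfl⟩), y, ?_⟩
    simp only [Function.update_self]
    omega
  · have hdq : 2 ^ Nat.log 2 (q + 1) ≤ q + 1 := Nat.pow_log_le_self 2 q.succ_ne_zero
    have hqd : q + 1 < 2 ^ (Nat.log 2 (q + 1) + 1) := Nat.lt_pow_succ_log_self one_lt_two _
    generalize Nat.log 2 (q + 1) = d at *
    rw [pow_succ] at hqd
    obtain ⟨m, hm⟩ := Nat.exists_eq_add_of_le hdq
    obtain ⟨l, hl⟩ : ∃ l, m + l + 1 = 2 ^ d := ⟨2 ^ d - 1 - m, by omega⟩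
    have hmq : m ≤ q := by have := Nat.two_pow_pos d; omega
    have hlq : l ≤ q := by omega
    obtain ⟨B, hB, hBx, hBy⟩ := exists_pourSteps_of_binary hxy hxz hyz (A := A) hl
      (by nlinarith) (by nlinarith)
    have hmul : (q + 1) * A x = (2 ^ d + m) * A x := by rw [hm]
    have hBr : B y + A x = B x + r := by nlinarith
    have hdx : 2 ^ d * A x ≤ (q + 1) * A x := Nat.mul_le_mul_right _ hdq
    refine ⟨d + 1, steps_le (by nlinarith), _,
      hB.trans (PourStep.pourSteps ⟨y, x, hxy.symm, by omega, rfl⟩), x, ?_⟩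
    simp only [Function.update_self]
    omega

theorem exists_sorted_indices (A : Fin 3 → ℕ) :
    ∃ x y z : Fin 3, x ≠ y ∧ x ≠ z ∧ y ≠ z ∧ A x ≤ A y ∧ A y ≤ A z ∧
      A x + A y + A z = ∑ i, A i ∧ ∀ i, A x ≤ A i := by
  have hmono := Tuple.monotone_sort A
  refine ⟨Tuple.sort A 0, Tuple.sort A 1, Tuple.sort A 2, by simp, by simp, by simp,
    hmono (by decide), hmono (by decide), ?_, fun i => ?_⟩
  · rw [← Equiv.sum_comp (Tuple.sort A) A, Fin.sum_univ_three]
  · simpa using hmono (Fin.zero_le ((Tuple.sort A).symm i))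

theorem pourable_of_lt_two_pow {t : ℕ} {A : Fin 3 → ℕ} {i : Fin 3} (hi : A i < 2 ^ t) :
    Pourable (t * Nat.log 2 (∑ i, A i)) A := by
  induction t generalizing A i with
  | zero => exact ⟨0, Nat.zero_le _, A, rfl, i, by simpa using hi⟩
  | succ t ih =>
    obtain ⟨x, y, z, hxy, hxz, hyz, hxy', hyz', hsum, hmin⟩ := exists_sorted_indices A
    rcases (A x).eq_zero_or_pos with h0 | hpos
    · exact ⟨0, Nat.zero_le _, A, rfl, x, h0⟩
    obtain ⟨p, hp, B, hB, j, hj⟩ := exists_pourSteps_two_mul_le hxy hxz hyz hpos hxy' hyz'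
    rw [pow_succ] at hi
    have hBj : B j < 2 ^ t := by have := hmin i; omega
    refine (hB.pourable (ih hBj)).mono ?_
    rw [hB.sum_eq, ← hsum, Nat.succ_mul]
    omega

theorem pourable_log_sq (A : Fin 3 → ℕ) :
    Pourable (Nat.log 2 (∑ i, A i) * Nat.log 2 (∑ i, A i)) A := by
  obtain ⟨x, y, z, -, -, -, hxy, hyz, hsum, -⟩ := exists_sorted_indices A
  apply pourable_of_lt_two_pow (i := x)
  have := Nat.lt_pow_succ_log_self one_lt_two (∑ i, A i)
  rw [pow_succ] at this
  omega

theorem stmt4 (N : ℕ) (hN : 0 < N) (A : Fin 3 → ℕ)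
    (h : ¬ Pourable (N - 1) A) :
    (2 : ℝ) ^ (Real.sqrt N) ≤ (∑ i, A i : ℕ) := by
  have hsum : ∑ i, A i ≠ 0 := fun h0 =>
    h ⟨0, Nat.zero_le _, A, rfl, 0, Finset.sum_eq_zero_iff.mp h0 0 (Finset.mem_univ 0)⟩
  have hN' : N ≤ Nat.log 2 (∑ i, A i) * Nat.log 2 (∑ i, A i) := by
    by_contra! hlt
    exact h ((pourable_log_sq A).mono (by omega))
  have hpow := Nat.pow_log_le_self 2 hsum
  generalize Nat.log 2 (∑ i, A i) = K at *
  have hsqrt : Real.sqrt N ≤ K := by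
    apply Real.sqrt_le_iff.mpr ⟨K.cast_nonneg, ?_⟩
    rw [sq]
    exact_mod_cast hN'
  calc (2 : ℝ) ^ Real.sqrt N ≤ 2 ^ (K : ℝ) :=
        Real.rpow_le_rpow_of_exponent_le one_le_two hsqrt
    _ = ((2 ^ K : ℕ) : ℝ) := by rw [Real.rpow_natCast]; push_cast; rfl
    _ ≤ (∑ i, A i : ℕ) := by exact_mod_cast hpow
end

section
/- For every positive integer N and every positive integer n, if every state on 3 vessels with sum n is N-pourable, then n ≤ 5·2^N − 1. -/
/-- A state on three vessels that, up to an error `ℓ / 3` in each entry, is a permutation of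
`(0, n / 3, 2 * n / 3)`, with the small entry positive. -/
def NearThirds (n ℓ : ℕ) (A : Fin 3 → ℕ) : Prop :=
  ∃ z t w : Fin 3, z ≠ t ∧ z ≠ w ∧ t ≠ w ∧ 0 < A z ∧ 3 * A z ≤ ℓ ∧
    3 * A t ≤ n + ℓ ∧ n ≤ 3 * A t + ℓ ∧ 3 * A w ≤ 2 * n + ℓ ∧ 2 * n ≤ 3 * A w + ℓ

lemma Fin.eq_or_eq_or_eq_of_ne {z t w : Fin 3} (hzt : z ≠ t) (hzw : z ≠ w) (htw : t ≠ w)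
    (i : Fin 3) : i = z ∨ i = t ∨ i = w := by
  omega

lemma NearThirds.ne_zero {n ℓ : ℕ} {A : Fin 3 → ℕ} (hA : NearThirds n ℓ A) (hℓ : ℓ < n)
    (i : Fin 3) : A i ≠ 0 := by
  obtain ⟨z, t, w, hzt, hzw, htw, _⟩ := hA
  rcases Fin.eq_or_eq_or_eq_of_ne hzt hzw htw i with rfl | rfl | rfl <;> omega

/-- While the errors are small, the only possible pouring steps double the small entry, or pour
the largest entry into the middle one and thereby swap their roles. -/
lemma NearThirds.pourStep {n ℓ : ℕ} {A B : Fin 3 → ℕ} (hA : NearThirds n ℓ A)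
    (hℓ : 2 * ℓ < n) (hAB : PourStep A B) : NearThirds n (2 * ℓ) B := by
  obtain ⟨z, t, w, hzt, hzw, htw, _⟩ := hA
  obtain ⟨i, j, hij, hle, rfl⟩ := hAB
  rcases Fin.eq_or_eq_or_eq_of_ne hzt hzw htw i with rfl | rfl | rfl <;>
    rcases Fin.eq_or_eq_or_eq_of_ne hzt hzw htw j with rfl | rfl | rfl <;>
    first
    | exact absurd rfl hij
    | omega
    | (refine ⟨z, j, i, hzw, hzt, htw.symm, ?_⟩
       simp [*]
       omega)
    | (refine ⟨i, j, w, hzt, hzw, htw, ?_⟩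
       simp [*, Ne.symm]
       omega)
    | (refine ⟨i, t, j, hzt, hzw, htw, ?_⟩
       simp [*, Ne.symm]
       omega)

lemma NearThirds.pourSteps_ne_zero {n m : ℕ} : ∀ {ℓ : ℕ} {A B : Fin 3 → ℕ},
    NearThirds n ℓ A → ℓ * 2 ^ m < n → PourSteps m A B → ∀ i, B i ≠ 0 := by
  induction m with
  | zero =>
    rintro ℓ A B hA hℓ rfl
    exact hA.ne_zero (by simpa using hℓ)
  | succ m ih =>
    rintro ℓ A B hA hℓ ⟨C, hAC, hCB⟩
    have hlt : 2 * ℓ * 2 ^ m < n := by rwa [pow_succ', ← mul_assoc, mul_comm ℓ 2] at hℓ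
    have hle : 2 * ℓ ≤ 2 * ℓ * 2 ^ m := Nat.le_mul_of_pos_right _ (by positivity)
    exact ih (hA.pourStep (by omega) hAC) hlt hCB

theorem stmt5 (N n : ℕ) (hN : 0 < N) (hn : 0 < n)
    (h : ∀ A : Fin 3 → ℕ, (∑ i, A i) = n → Pourable N A) :
    n ≤ 5 * 2 ^ N - 1 := by
  by_contra! hlt
  have hpos : 0 < 2 ^ N := by positivity
  obtain ⟨m, hm, B, hB, i, hi⟩ := h ![1, n / 3, n - 1 - n / 3] (by
    simp [Fin.sum_univ_three]
    omega)
  have hnear : NearThirds n 3 ![1, n / 3, n - 1 - n / 3] := by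
    refine ⟨0, 1, 2, by decide, by decide, by decide, ?_⟩
    simp
    omega
  have hmN : 2 ^ m ≤ 2 ^ N := Nat.pow_le_pow_right two_pos hm
  exact hnear.pourSteps_ne_zero (by omega) hB i hi
end

section
/- Let a, b, c, q be positive integers with a ≤ b ≤ c and b = q·a + r where 0 ≤ r < a, and let h = ⌊log₂ q⌋. Then there is a sequence of exactly h pouring steps transforming the state (a, b, c) into the state (2^h·a, 2^h·a + r, c') for some positive integer c'. -/
/-- Repeated doubling of the first vessel, pouring out of the second vessel at the nonzero
binary digits of `q` below the leading one, and out of the third vessel at the zero digits. -/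
theorem exists_pourSteps_binary (h : ℕ) : ∀ a c q r : ℕ, 2 ^ h ≤ q → q < 2 ^ (h + 1) →
    2 ^ h * a < c + a →
    ∃ c' : ℕ, 0 < c' ∧
      PourSteps h ![a, q * a + r, c] ![2 ^ h * a, 2 ^ h * a + r, c'] := by
  induction h with
  | zero =>
    intro a c q r h1 h2 hc
    obtain rfl : q = 1 := by simp at h1 h2; omega
    refine ⟨c, by simpa using hc, ?_⟩
    simp [PourSteps]
  | succ h ih =>
    intro a c q r h1 h2 hc
    have hp : 1 ≤ 2 ^ h := Nat.one_le_two_pow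
    have hpa : a ≤ 2 ^ h * a := Nat.le_mul_of_pos_left a hp
    have e : 2 ^ (h + 1) * a = 2 ^ h * (2 * a) := by ring
    have e' : 2 ^ h * (2 * a) = 2 * (2 ^ h * a) := by ring
    rw [pow_succ] at h1
    rw [pow_succ] at h2
    rw [e] at hc ⊢
    rcases Nat.even_or_odd' q with ⟨p, rfl | rfl⟩
    · obtain ⟨c', hc', hs⟩ := ih (2 * a) (c - a) p r (by omega) (by omega) (by omega)
      refine ⟨c', hc', _, ⟨0, 2, by decide, ?_, ?_⟩, hs⟩
      · simp only [Matrix.cons_val]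
        omega
      · ext i
        fin_cases i <;> simp [Function.update]
        ring
    · obtain ⟨c', hc', hs⟩ := ih (2 * a) c p r (by omega) (by omega) (by omega)
      have e2 : (2 * p + 1) * a + r = p * (2 * a) + r + a := by ring
      refine ⟨c', hc', _, ⟨0, 1, by decide, ?_, ?_⟩, hs⟩
      · simp only [Matrix.cons_val]
        omega
      · ext i
        fin_cases i <;> simp [Function.update, e2]

theorem stmt6 (a b c q r : ℕ) (ha : 0 < a) (hb : 0 < b) (hc : 0 < c) (hq : 0 < q)
    (hab : a ≤ b) (hbc : b ≤ c) (hbr : b = q * a + r) (hr : r < a) :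
    ∃ c' : ℕ, 0 < c' ∧
      PourSteps (Nat.log 2 q) ![a, b, c] ![2 ^ Nat.log 2 q * a, 2 ^ Nat.log 2 q * a + r, c'] := by
  subst hbr
  have hle : 2 ^ Nat.log 2 q ≤ q := Nat.pow_log_le_self 2 hq.ne'
  have hmul : 2 ^ Nat.log 2 q * a ≤ q * a := Nat.mul_le_mul_right a hle
  exact exists_pourSteps_binary _ a c q r hle (Nat.lt_pow_succ_log_self one_lt_two q) (by omega)
end

section
/- Let a, b, c be positive integers with a ≤ b ≤ c, let n = a+b+c, and write b = q·a + r with q a positive integer and 0 ≤ r < a. Then the state (a, b, c) is ((r+1)·⌊log₂ n⌋)-pourable. -/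
theorem PourSteps.trans_s7 {k m l : ℕ} {A B C : Fin k → ℕ} (h₁ : PourSteps m A B)
    (h₂ : PourSteps l B C) : PourSteps (m + l) A C := by
  induction m generalizing A with
  | zero =>
    obtain rfl : B = A := h₁
    simpa using h₂
  | succ m ih =>
    obtain ⟨D, hAD, hDB⟩ := h₁
    rw [Nat.add_right_comm]
    exact ⟨D, hAD, ih hDB⟩

/-- A single pour from `j` into `i`, described on `i`, `j` and any third vessel. -/
theorem exists_pourStep {k : ℕ} {A : Fin k → ℕ} {i j l : Fin k} (hij : i ≠ j) (hil : i ≠ l)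
    (hjl : j ≠ l) (h : A i ≤ A j) :
    ∃ B, PourStep A B ∧ B i = 2 * A i ∧ B j = A j - A i ∧ B l = A l :=
  ⟨_, ⟨i, j, hij, h, rfl⟩, by simp [hij], by simp, by simp [hil.symm, hjl.symm]⟩

/-- Reading the binary digits of `q` from the least significant one, pour into `x` from `y` on a
digit `1` and from `z` on a digit `0`. In total this removes `q * A x` from `y`. -/
theorem exists_pourSteps_sub_mul {k : ℕ} {x y z : Fin k} (hxy : x ≠ y) (hxz : x ≠ z) (hyz : y ≠ z)
    {q : ℕ} (hq : 0 < q) (A : Fin k → ℕ) (hy : q * A x ≤ A y) (hz : q * A x ≤ A z + A x) :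
    ∃ B, PourSteps (Nat.log 2 q + 1) A B ∧ B y + q * A x = A y ∧
      B x + B y + B z = A x + A y + A z ∧ A x ≤ B x ∧ A z + A x ≤ B z + q * A x := by
  induction q using Nat.strong_induction_on generalizing A with
  | _ q ih =>
    obtain rfl | hq₂ : q = 1 ∨ 2 ≤ q := by omega
    · obtain ⟨B, hB, hBx, hBy, hBz⟩ := exists_pourStep hxy hxz hyz (by simpa using hy)
      exact ⟨B, ⟨B, hB, rfl⟩, by omega, by omega, by omega, by omega⟩
    have hlog : Nat.log 2 q = Nat.log 2 (q / 2) + 1 := Nat.log_of_one_lt_of_le one_lt_two hq₂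
    have hle : 2 * A x ≤ q * A x := Nat.mul_le_mul_right _ hq₂
    obtain ⟨p, hp⟩ : ∃ p, p = q / 2 := ⟨_, rfl⟩
    rw [hlog, ← hp]
    obtain hd | hd : q = 2 * p ∨ q = 2 * p + 1 := by omega
    · have hmul : p * (2 * A x) = q * A x := by rw [hd]; ring
      obtain ⟨C, hC, hCx, hCz, hCy⟩ :=
        exists_pourStep (A := A) hxz hxy hyz.symm (by omega)
      rw [← hCx] at hmul
      obtain ⟨B, hB, hBy, hsum, hBx, hBz⟩ := ih p (by omega) (by omega) C (by omega) (by omega)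
      exact ⟨B, ⟨C, hC, hB⟩, by omega, by omega, by omega, by omega⟩
    · have hmul : p * (2 * A x) + A x = q * A x := by rw [hd]; ring
      obtain ⟨C, hC, hCx, hCy, hCz⟩ :=
        exists_pourStep (A := A) hxy hxz hyz (by omega)
      rw [← hCx] at hmul
      obtain ⟨B, hB, hBy, hsum, hBx, hBz⟩ := ih p (by omega) (by omega) C (by omega) (by omega)
      exact ⟨B, ⟨C, hC, hB⟩, by omega, by omega, by omega, by omega⟩

theorem pourable_mod_add_one_mul_log {k : ℕ} {x y z : Fin k} (hxy : x ≠ y) (hxz : x ≠ z)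
    (hyz : y ≠ z) (A : Fin k → ℕ) (hx : 0 < A x) (hy : A x ≤ A y) (hz : A y ≤ A z) :
    Pourable ((A y % A x + 1) * Nat.log 2 (A x + A y + A z)) A := by
  induction hr : A y % A x using Nat.strong_induction_on generalizing A x y z with
  | _ r ih =>
    have hdiv : A y / A x * A x + r = A y := by rw [← hr]; exact Nat.div_add_mod' _ _
    have hq : 0 < A y / A x := Nat.div_pos hy hx
    obtain ⟨q, hq_def⟩ : ∃ q, q = A y / A x := ⟨_, rfl⟩
    rw [← hq_def] at hdiv hq
    obtain ⟨B, hB, hBy, hsum, hBx, hBz⟩ :=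
      exists_pourSteps_sub_mul hxy hxz hyz hq A (by omega) (by omega)
    have hlog : Nat.log 2 q + 1 ≤ Nat.log 2 (A x + A y + A z) := by
      rw [← Nat.log_mul_base one_lt_two hq.ne']
      have := Nat.le_mul_of_pos_right q hx
      exact Nat.log_mono_right (by omega)
    have hBr : B y = r := by omega
    have hrx : r < A x := hr ▸ Nat.mod_lt _ hx
    obtain hr₀ | hr₀ := Nat.eq_zero_or_pos r
    · exact ⟨_, by simpa [hr₀] using hlog, B, hB, y, by omega⟩
    have hrec : ∃ s < r, Pourable ((s + 1) * Nat.log 2 (A x + A y + A z)) B := by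
      obtain hxz' | hxz' := le_total (B x) (B z)
      · have hlt : B x % B y < r := hBr ▸ Nat.mod_lt _ (by omega)
        refine ⟨_, hlt, ?_⟩
        rw [← hsum, Nat.add_comm (B x) (B y)]
        exact ih _ hlt hxy.symm hyz hxz B (by omega) (by omega) hxz' rfl
      · have hlt : B z % B y < r := hBr ▸ Nat.mod_lt _ (by omega)
        refine ⟨_, hlt, ?_⟩
        rw [← hsum, show B x + B y + B z = B y + B z + B x by ring]
        exact ih _ hlt hyz hxy.symm hxz.symm B (by omega) (by omega) hxz' rfl
    obtain ⟨s, hs, m, hm, C, hC, hC₀⟩ := hrec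
    refine ⟨_, ?_, C, hB.trans_s7 hC, hC₀⟩
    calc Nat.log 2 q + 1 + m
        ≤ Nat.log 2 (A x + A y + A z) + (s + 1) * Nat.log 2 (A x + A y + A z) :=
          Nat.add_le_add hlog hm
      _ = (s + 2) * Nat.log 2 (A x + A y + A z) := by ring
      _ ≤ (r + 1) * Nat.log 2 (A x + A y + A z) := Nat.mul_le_mul_right _ (by omega)

theorem stmt7 (a b c q r : ℕ) (ha : 0 < a) (hb : 0 < b) (hc : 0 < c) (hq : 0 < q)
    (hab : a ≤ b) (hbc : b ≤ c) (hbr : b = q * a + r) (hr : r < a) :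
    Pourable ((r + 1) * Nat.log 2 (a + b + c)) ![a, b, c] := by
  have hmod : b % a = r := by rw [hbr, Nat.mul_add_mod_of_lt hr]
  rw [← hmod]
  exact pourable_mod_add_one_mul_log (x := 0) (y := 1) (z := 2) (by decide) (by decide)
    (by decide) ![a, b, c] ha hab hbc
end

section
/- Let a, b, c be positive integers, and suppose the state (a', b', c') is reachable from the state (a, b, c) by some finite sequence of pouring steps. Then gcd(a', b', c') = 2^t · gcd(a, b, c) for some nonnegative integer t. -/
theorem PourStep.gcd_dvd_gcd {k : ℕ} {A B : Fin k → ℕ} (h : PourStep A B) :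
    Finset.univ.gcd A ∣ Finset.univ.gcd B := by
  obtain ⟨i, j, -, -, rfl⟩ := h
  have hA (l : Fin k) : Finset.univ.gcd A ∣ A l := Finset.gcd_dvd (Finset.mem_univ l)
  refine Finset.dvd_gcd fun l _ => ?_
  rw [Function.update_apply, Function.update_apply]
  split_ifs
  · exact Nat.dvd_sub (hA j) (hA i)
  · exact (hA i).mul_left 2
  · exact hA l

theorem PourStep.gcd_dvd_two_mul_gcd {k : ℕ} {A B : Fin k → ℕ} (h : PourStep A B) :
    Finset.univ.gcd B ∣ 2 * Finset.univ.gcd A := by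
  obtain ⟨i, j, hij, hle, hB⟩ := h
  have hdvd (l : Fin k) : Finset.univ.gcd B ∣ B l := Finset.gcd_dvd (Finset.mem_univ l)
  have hi : Finset.univ.gcd B ∣ 2 * A i := by
    have := hdvd i
    rwa [congrFun hB i, Function.update_of_ne hij, Function.update_self] at this
  have hj : Finset.univ.gcd B ∣ A j - A i := by
    have := hdvd j
    rwa [congrFun hB j, Function.update_self] at this
  have hmul : (Finset.univ.gcd fun l => 2 * A l) = 2 * Finset.univ.gcd A := by
    rw [Finset.gcd_mul_left, normalize_eq]
  rw [← hmul]
  refine Finset.dvd_gcd fun l _ => ?_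
  by_cases hlj : l = j
  · subst hlj
    have hsum : 2 * A l = 2 * (A l - A i) + 2 * A i := by lia
    rw [hsum]
    exact dvd_add (hj.mul_left 2) hi
  · by_cases hli : l = i
    · exact hli ▸ hi
    · have := hdvd l
      rw [congrFun hB l, Function.update_of_ne hlj, Function.update_of_ne hli] at this
      exact this.mul_left 2

theorem PourStep.exists_gcd_eq {k : ℕ} {A B : Fin k → ℕ} (h : PourStep A B) :
    ∃ t : ℕ, Finset.univ.gcd B = 2 ^ t * Finset.univ.gcd A := by
  obtain ⟨d, hd⟩ := h.gcd_dvd_gcd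
  rcases Nat.eq_zero_or_pos (Finset.univ.gcd A) with h0 | hpos
  · exact ⟨0, by simp [hd, h0]⟩
  · have h2 := h.gcd_dvd_two_mul_gcd
    rw [hd, mul_comm] at h2
    obtain rfl | rfl := (Nat.dvd_prime Nat.prime_two).mp (Nat.dvd_of_mul_dvd_mul_right hpos h2)
    · exact ⟨0, by rw [hd]; ring⟩
    · exact ⟨1, by rw [hd]; ring⟩

theorem PourSteps.exists_gcd_eq {k m : ℕ} {A B : Fin k → ℕ} (h : PourSteps m A B) :
    ∃ t : ℕ, Finset.univ.gcd B = 2 ^ t * Finset.univ.gcd A := by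
  induction m generalizing A with
  | zero =>
    obtain rfl : B = A := h
    exact ⟨0, by simp⟩
  | succ m ih =>
    obtain ⟨C, hAC, hCB⟩ := h
    obtain ⟨s, hs⟩ := hAC.exists_gcd_eq
    obtain ⟨t, ht⟩ := ih hCB
    exact ⟨t + s, by rw [ht, hs]; ring⟩

theorem Finset.univ_gcd_vec_three (a b c : ℕ) :
    Finset.univ.gcd ![a, b, c] = Nat.gcd a (Nat.gcd b c) := by
  have huniv : (Finset.univ : Finset (Fin 3)) = {0, 1, 2} := rfl
  simp [huniv, Finset.gcd_insert, gcd_eq_nat_gcd]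

theorem stmt9 (a b c a' b' c' : ℕ) (ha : 0 < a) (hb : 0 < b) (hc : 0 < c)
    (h : ∃ m : ℕ, PourSteps m ![a, b, c] ![a', b', c']) :
    ∃ t : ℕ, Nat.gcd a' (Nat.gcd b' c') = 2 ^ t * Nat.gcd a (Nat.gcd b c) := by
  obtain ⟨m, hm⟩ := h
  simpa only [Finset.univ_gcd_vec_three] using hm.exists_gcd_eq
end

section
/- Let N ≥ 1 and k ≥ 3 be integers, and assume that some state on k+1 vessels is not (N−1)-pourable (so that g(N,k+1) is well-defined). Then (k+1)·g(N,k) ≤ k·g(N,k+1). -/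
/-- `g N k` : the smallest positive integer `n` such that some state on `k`
vessels with sum `n` is not `(N-1)`-pourable. -/
noncomputable def g (N k : ℕ) : ℕ :=
  sInf {n : ℕ | 0 < n ∧ ∃ A : Fin k → ℕ, (∑ i, A i) = n ∧ ¬ Pourable (N - 1) A}

/-- A pouring step on part of the vessels extends to all of them. -/
theorem PourStep.extend {k l : ℕ} {f : Fin k → Fin l} (hf : f.Injective) {A : Fin l → ℕ}
    {B : Fin k → ℕ} (h : PourStep (A ∘ f) B) : ∃ C, PourStep A C ∧ C ∘ f = B := by
  obtain ⟨i, j, hij, hle, rfl⟩ := h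
  refine ⟨_, ⟨f i, f j, hf.ne hij, hle, rfl⟩, ?_⟩
  rw [Function.update_comp_eq_of_injective _ hf, Function.update_comp_eq_of_injective _ hf]
  rfl

/-- A sequence of pouring steps on part of the vessels extends to all of them. -/
theorem PourSteps.extend {k l : ℕ} {f : Fin k → Fin l} (hf : f.Injective) {m : ℕ}
    {A : Fin l → ℕ} {B : Fin k → ℕ} (h : PourSteps m (A ∘ f) B) :
    ∃ C, PourSteps m A C ∧ C ∘ f = B := by
  induction m generalizing A with
  | zero => exact ⟨A, rfl, Eq.symm h⟩
  | succ m ih =>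
    obtain ⟨D, hD, hDB⟩ := h
    obtain ⟨E, hAE, rfl⟩ := hD.extend hf
    obtain ⟨C, hEC, hC⟩ := ih hDB
    exact ⟨C, ⟨E, hAE, hEC⟩, hC⟩

/-- A state is pourable as soon as its restriction to some of the vessels is. -/
theorem Pourable.of_comp {k l : ℕ} {f : Fin k → Fin l} (hf : f.Injective) {p : ℕ}
    {A : Fin l → ℕ} (h : Pourable p (A ∘ f)) : Pourable p A := by
  obtain ⟨m, hm, B, hB, i, hi⟩ := h
  obtain ⟨C, hC, rfl⟩ := hB.extend hf
  exact ⟨m, hm, C, hC, f i, hi⟩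

/-- A state on at least one vessel that is not pourable has a positive sum. -/
theorem sum_pos_of_not_pourable {k p : ℕ} (hk : 0 < k) {A : Fin k → ℕ} (h : ¬ Pourable p A) :
    0 < ∑ i, A i := by
  have hA (i : Fin k) : 0 < A i :=
    Nat.pos_of_ne_zero fun hi => h ⟨0, p.zero_le, A, rfl, i, hi⟩
  exact (hA ⟨0, hk⟩).trans_le (Finset.single_le_sum (fun _ _ => Nat.zero_le _) (Finset.mem_univ _))

/-- The sum of a state that is not `(N - 1)`-pourable bounds `g N k` from above. -/
theorem g_le_sum {N k : ℕ} (hk : 0 < k) {A : Fin k → ℕ} (h : ¬ Pourable (N - 1) A) :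
    g N k ≤ ∑ i, A i :=
  Nat.sInf_le ⟨sum_pos_of_not_pourable hk h, A, rfl, h⟩

/-- The value `g N k` is attained when some state on `k` vessels is not `(N - 1)`-pourable. -/
theorem exists_sum_eq_g {N k : ℕ} (hk : 0 < k) (h : ∃ A : Fin k → ℕ, ¬ Pourable (N - 1) A) :
    ∃ A : Fin k → ℕ, ∑ i, A i = g N k ∧ ¬ Pourable (N - 1) A := by
  obtain ⟨A, hA⟩ := h
  exact (Nat.sInf_mem (s := {n : ℕ | 0 < n ∧ ∃ A : Fin k → ℕ, (∑ i, A i) = n ∧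
    ¬ Pourable (N - 1) A}) ⟨_, sum_pos_of_not_pourable hk hA, A, rfl, hA⟩).2

theorem stmt13 (N k : ℕ) (hN : 1 ≤ N) (hk : 3 ≤ k)
    (h : ∃ A : Fin (k + 1) → ℕ, ¬ Pourable (N - 1) A) :
    (k + 1) * g N k ≤ k * g N (k + 1) := by
  obtain ⟨A, hsum, hA⟩ := exists_sum_eq_g k.succ_pos h
  obtain ⟨i, -, hi⟩ := Finset.exists_max_image Finset.univ A Finset.univ_nonempty
  have hg : g N k ≤ ∑ j, A (i.succAbove j) :=
    g_le_sum (by omega) fun hp => hA (hp.of_comp i.succAbove_right_injective)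
  have hmax : ∑ j, A j ≤ (k + 1) * A i := by
    simpa using Finset.sum_le_card_nsmul Finset.univ A (A i) hi
  rw [Fin.sum_univ_succAbove A i] at hsum hmax
  nlinarith
end

section
/- For every integer k ≥ 3, g(2,k) = k(k+1)/2; that is, the smallest positive integer n such that some state on k vessels with sum n is not 1-pourable equals k(k+1)/2. -/
/-- A state is not `1`-pourable exactly when its entries are positive and pairwise distinct. -/
theorem not_pourable_one_iff {k : ℕ} (A : Fin k → ℕ) :
    ¬ Pourable 1 A ↔ (∀ i, 0 < A i) ∧ Function.Injective A := by
  constructor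
  · intro h
    refine ⟨fun i => Nat.pos_of_ne_zero fun hi => h ⟨0, by omega, A, rfl, i, hi⟩, ?_⟩
    intro i j hij
    by_contra hne
    exact h ⟨1, le_rfl, _, ⟨_, ⟨i, j, hne, hij.le, rfl⟩, rfl⟩, j, by simp [hij]⟩
  · rintro ⟨hpos, hinj⟩ ⟨m, hm, B, hB, l, hl⟩
    obtain rfl | rfl : m = 0 ∨ m = 1 := by omega
    · rw [show B = A from hB] at hl
      exact (hpos l).ne' hl
    · obtain ⟨C, ⟨i, j, hne, hle, rfl⟩, hC⟩ := hB
      rw [show B = _ from hC] at hl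
      have hlt : A i < A j := lt_of_le_of_ne hle (hinj.ne hne)
      have hi := hpos i
      have hl' := hpos l
      simp only [Function.update_apply] at hl
      split_ifs at hl <;> omega

/-- A finite set of `m` positive integers has sum at least `m (m + 1) / 2`. -/
theorem card_mul_card_add_one_le_two_mul_sum (s : Finset ℕ) (hs : ∀ x ∈ s, 0 < x) :
    s.card * (s.card + 1) ≤ 2 * ∑ x ∈ s, x := by
  induction s using Finset.induction_on_max with
  | empty => simp
  | insert a s ha ih =>
    have hmem : a ∉ s := fun h => lt_irrefl a (ha a h)
    have hsum := ih fun x hx => hs x (Finset.mem_insert_of_mem hx)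
    have hsub : s ⊆ Finset.Ico 1 a := fun x hx =>
      Finset.mem_Ico.2 ⟨hs x (Finset.mem_insert_of_mem hx), ha x hx⟩
    have hcard := Finset.card_le_card hsub
    rw [Nat.card_Ico] at hcard
    have hapos := hs a (Finset.mem_insert_self a s)
    have hle : s.card + 1 ≤ a := by omega
    rw [Finset.card_insert_of_notMem hmem, Finset.sum_insert hmem]
    nlinarith

theorem stmt15 (k : ℕ) (hk : 3 ≤ k) : g 2 k = k * (k + 1) / 2 := by
  have hsum : ∑ i : Fin k, ((i : ℕ) + 1) = k * (k + 1) / 2 := by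
    have h := Finset.sum_range_succ' (fun i => i) k
    rw [Finset.sum_range_id, Nat.add_sub_cancel, Nat.mul_comm, add_zero] at h
    rw [Fin.sum_univ_eq_sum_range (fun i => i + 1), h]
  apply IsLeast.csInf_eq
  constructor
  · refine ⟨Nat.div_pos (by nlinarith) (by norm_num), fun i => (i : ℕ) + 1, hsum, ?_⟩
    exact (not_pourable_one_iff _).2
      ⟨fun i => Nat.succ_pos _, fun i j h => Fin.ext (Nat.succ_injective h)⟩
  · rintro n ⟨-, A, rfl, hA⟩
    obtain ⟨hpos, hinj⟩ := (not_pourable_one_iff A).1 hA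
    have h := card_mul_card_add_one_le_two_mul_sum (Finset.univ.image A) (by simpa using hpos)
    rw [Finset.card_image_of_injective _ hinj, Finset.sum_image hinj.injOn, Finset.card_univ,
      Fintype.card_fin] at h
    omega
end

section
/- For every integer k ≥ 3, g(3,k) ≤ ⌊5k²/4⌋; that is, there exists a positive integer n ≤ ⌊5k²/4⌋ and a state on k vessels with sum n that is not 2-pourable. -/
/-- Pouring between vessels of a state with distinct positive entries empties no vessel. -/
theorem PourStep.pos {k : ℕ} {A B : Fin k → ℕ} (h : PourStep A B) (hpos : ∀ i, 0 < A i)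
    (hinj : Function.Injective A) (l : Fin k) : 0 < B l := by
  obtain ⟨i, j, hij, hle, rfl⟩ := h
  have hlt : A i < A j := lt_of_le_of_ne hle (hinj.ne hij)
  have hi := hpos i
  have hl := hpos l
  simp only [Function.update_apply]
  split_ifs <;> omega

/-- Sums, doubles and triples of numbers congruent to `1` or `4` modulo `5` leave these two classes,
so a pouring step from a state with distinct entries in them keeps the entries distinct. -/
theorem PourStep.injective_of_mod_five {k : ℕ} {A B : Fin k → ℕ} (h : PourStep A B)
    (hmod : ∀ i, A i % 5 = 1 ∨ A i % 5 = 4) (hinj : Function.Injective A) :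
    Function.Injective B := by
  obtain ⟨i, j, hij, hle, rfl⟩ := h
  intro p q hpq
  by_contra hne
  have hA : A p ≠ A q := hinj.ne hne
  have hi := hmod i
  have hj := hmod j
  have hp := hmod p
  have hq := hmod q
  simp only [Function.update_apply] at hpq
  split_ifs at hpq <;> omega

theorem not_pourable_two_of_mod_five {k : ℕ} {A : Fin k → ℕ}
    (hmod : ∀ i, A i % 5 = 1 ∨ A i % 5 = 4) (hinj : Function.Injective A) :
    ¬ Pourable 2 A := by
  have hpos : ∀ i, 0 < A i := fun i => by have := hmod i; omega
  rintro ⟨m, hm, B, hB, i, hi⟩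
  refine absurd hi (Nat.pos_iff_ne_zero.mp ?_)
  interval_cases m
  · obtain rfl : B = A := hB
    exact hpos i
  · obtain ⟨C, hC, rfl : B = C⟩ := hB
    exact hC.pos hpos hinj i
  · obtain ⟨C, hC, D, hD, rfl : B = D⟩ := hB
    exact hD.pos (hC.pos hpos hinj) (hC.injective_of_mod_five hmod hinj) i

/-- The sum of the first `k` positive integers congruent to `1` or `4` modulo `5`. -/
theorem sum_range_five_mul_add_three_div_two (k : ℕ) :
    ∑ i ∈ Finset.range k, (5 * i + 3) / 2 = 5 * k ^ 2 / 4 := by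
  induction k with
  | zero => simp
  | succ k ih =>
    rw [Finset.sum_range_succ, ih]
    obtain ⟨m, rfl | rfl⟩ := Nat.even_or_odd' k <;> ring_nf <;> omega

theorem stmt16 (k : ℕ) (hk : 3 ≤ k) :
    g 3 k ≤ 5 * k ^ 2 / 4 ∧
      ∃ A : Fin k → ℕ, 0 < (∑ i, A i) ∧ (∑ i, A i) ≤ 5 * k ^ 2 / 4 ∧
        ¬ Pourable 2 A := by
  have hmod : ∀ i : Fin k, (5 * (i : ℕ) + 3) / 2 % 5 = 1 ∨ (5 * (i : ℕ) + 3) / 2 % 5 = 4 :=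
    fun i => by obtain ⟨m, hm | hm⟩ := Nat.even_or_odd' (i : ℕ) <;> omega
  have hinj : Function.Injective fun i : Fin k => (5 * (i : ℕ) + 3) / 2 :=
    fun i j hij => Fin.ext (by simp only at hij; omega)
  have hsum : ∑ i : Fin k, (5 * (i : ℕ) + 3) / 2 = 5 * k ^ 2 / 4 := by
    rw [Fin.sum_univ_eq_sum_range (fun i => (5 * i + 3) / 2),
      sum_range_five_mul_add_three_div_two]
  have hpos : 0 < 5 * k ^ 2 / 4 := Nat.div_pos (by nlinarith) (by norm_num)
  have hnot := not_pourable_two_of_mod_five hmod hinj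
  exact ⟨Nat.sInf_le ⟨hpos, _, hsum, hnot⟩, _, hsum.symm ▸ hpos, hsum.le, hnot⟩
end
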